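/- arXiv:2104.06674 — 6 statements merged into one kernel-verified Lean document; each statement's English description precedes it below -/
import Mathlib

section
/- Let t > 0, k ∈ ℕ and let f : ℝ^d × ℝ^d → ℂ be measurable with ‖f‖_{X_k} < ∞. Then the free transport semigroup satisfies the decay estimate ‖U₀(t)f‖_{X₀} ≤ (D^k / t^k) · ‖f‖_{X_k}, i.e. ∫_{Ω×ℝ^d} |f(x − t·v, v)|·1_{{t < t₋(x,v)}} dx m(dv) ≤ (D/t)^k ∫_{Ω×ℝ^d} max(1,|v|^{−k}) |f(x,v)| dx m(dv). -/
open MeasureTheory Set Filter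
open scoped ENNReal NNReal Topology

/-- The backward exit time `t₋(x,v) = inf {s > 0 : x - s • v ∉ Ω}` (with `inf ∅ = ∞`),
valued in `ℝ≥0∞`. -/
noncomputable def tminus {d : ℕ} (Ω : Set (EuclideanSpace ℝ (Fin d)))
    (x v : EuclideanSpace ℝ (Fin d)) : ℝ≥0∞ :=
  ⨅ (s : ℝ) (_ : 0 < s ∧ x - s • v ∉ Ω), ENNReal.ofReal s

/-- The norm `‖f‖_{X_s} = ∫_{Ω×ℝ^d} max(1,|v|^{-s}) |f(x,v)| dx m(dv)`. -/
noncomputable def Xnorm {d : ℕ} (Ω : Set (EuclideanSpace ℝ (Fin d)))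
    (m : Measure (EuclideanSpace ℝ (Fin d))) (s : ℕ)
    (f : EuclideanSpace ℝ (Fin d) → EuclideanSpace ℝ (Fin d) → ℂ) : ℝ≥0∞ :=
  ∫⁻ x in Ω, ∫⁻ v, ENNReal.ofReal (max 1 (‖v‖⁻¹ ^ s)) * (‖f x v‖₊ : ℝ≥0∞) ∂m

/-- The free transport semigroup `(U₀(t)f)(x,v) = f(x - t v, v) 1_{t < t₋(x,v)}`. -/
noncomputable def freeTransport {d : ℕ} (Ω : Set (EuclideanSpace ℝ (Fin d)))
    (t : ℝ) (f : EuclideanSpace ℝ (Fin d) → EuclideanSpace ℝ (Fin d) → ℂ)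
    (x v : EuclideanSpace ℝ (Fin d)) : ℂ :=
  if ENNReal.ofReal t < tminus Ω x v then f (x - t • v) v else 0

theorem sub_smul_mem_of_lt_tminus {d : ℕ} {Ω : Set (EuclideanSpace ℝ (Fin d))}
    {x v : EuclideanSpace ℝ (Fin d)} {t : ℝ} (ht : 0 < t)
    (h : ENNReal.ofReal t < tminus Ω x v) : x - t • v ∈ Ω := by
  by_contra hx
  exact absurd h (not_lt.mpr (iInf₂_le t ⟨ht, hx⟩))

/-- A chord of `Ω` with direction `v ≠ 0` travelled for a time `t` forces `1 ≤ (D / t) / |v|`. -/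
theorem one_le_diam_div_pow_mul_inv_norm_pow {E : Type*} [NormedAddCommGroup E]
    [NormedSpace ℝ E] {Ω : Set E} (hΩ : Bornology.IsBounded Ω) {x v : E} {t : ℝ} (ht : 0 < t)
    (hv : v ≠ 0) (hx : x ∈ Ω) (hy : x - t • v ∈ Ω) (k : ℕ) :
    1 ≤ (Metric.diam Ω / t) ^ k * ‖v‖⁻¹ ^ k := by
  have hdist := Metric.dist_le_diam_of_mem hΩ hx hy
  rw [dist_eq_norm, sub_sub_cancel, norm_smul, Real.norm_of_nonneg ht.le] at hdist
  have hv' : 0 < ‖v‖ := norm_pos_iff.mpr hv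
  rw [← mul_pow]
  apply one_le_pow₀
  rw [← div_eq_mul_inv, div_div, one_le_div (by positivity)]
  exact hdist

/-- Integrals over phase space are invariant under the free flow `(x, v) ↦ (x - t v, v)`. -/
theorem lintegral_lintegral_sub_smul {E : Type*} [NormedAddCommGroup E] [NormedSpace ℝ E]
    [MeasurableSpace E] [BorelSpace E] [SecondCountableTopology E]
    (μ m : Measure E) [SFinite μ] [μ.IsAddRightInvariant] [SFinite m] (t : ℝ)
    {g : E → E → ℝ≥0∞} (hg : Measurable (Function.uncurry g)) :
    ∫⁻ x, ∫⁻ v, g (x - t • v) v ∂m ∂μ = ∫⁻ x, ∫⁻ v, g x v ∂m ∂μ := by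
  have hflow : Measurable (fun p : E × E => (p.1 - t • p.2, p.2)) := by fun_prop
  rw [lintegral_lintegral_swap (f := fun x v => g (x - t • v) v) (hg.comp hflow).aemeasurable,
    lintegral_lintegral_swap hg.aemeasurable]
  exact lintegral_congr fun v => lintegral_sub_right_eq_self (fun x => g x v) (t • v)

/-- Decay of the free transport semigroup:
`‖U₀(t)f‖_{X₀} ≤ (D/t)^k ‖f‖_{X_k}` for `f ∈ X_k` and `t > 0`. -/
theorem freeTransport_decay {d : ℕ} (hd : 1 ≤ d)
    (Ω : Set (EuclideanSpace ℝ (Fin d))) (hΩopen : IsOpen Ω)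
    (hΩne : Ω.Nonempty) (hΩbdd : Bornology.IsBounded Ω)
    (m : Measure (EuclideanSpace ℝ (Fin d))) [SigmaFinite m] (hm0 : m {0} = 0)
    (t : ℝ) (ht : 0 < t) (k : ℕ)
    (f : EuclideanSpace ℝ (Fin d) → EuclideanSpace ℝ (Fin d) → ℂ)
    (hf : Measurable (Function.uncurry f))
    (hfX : Xnorm Ω m k f < ⊤) :
    Xnorm Ω m 0 (freeTransport Ω t f)
      ≤ ENNReal.ofReal ((Metric.diam Ω / t) ^ k) * Xnorm Ω m k f := by
  set C := ENNReal.ofReal ((Metric.diam Ω / t) ^ k)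
  let w : EuclideanSpace ℝ (Fin d) → EuclideanSpace ℝ (Fin d) → ℝ≥0∞ := fun x v =>
    ENNReal.ofReal (max 1 (‖v‖⁻¹ ^ k)) * (‖f x v‖₊ : ℝ≥0∞)
  let g : EuclideanSpace ℝ (Fin d) → EuclideanSpace ℝ (Fin d) → ℝ≥0∞ := fun x v =>
    Ω.indicator (fun y => w y v) x
  have hw : Measurable (Function.uncurry w) := by
    have h1 : Measurable fun p : EuclideanSpace ℝ (Fin d) × EuclideanSpace ℝ (Fin d) =>
        ENNReal.ofReal (max 1 (‖p.2‖⁻¹ ^ k)) := by fun_prop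
    exact h1.mul hf.nnnorm.coe_nnreal_ennreal
  have hg : Measurable (Function.uncurry g) :=
    hw.indicator (measurable_fst hΩopen.measurableSet)
  have hv0 : ∀ᵐ v ∂m, v ≠ 0 := by
    rw [ae_iff]
    simpa using hm0
  have hpoint : ∀ x ∈ Ω, ∀ v, v ≠ 0 →
      ENNReal.ofReal (max 1 (‖v‖⁻¹ ^ 0)) * (‖freeTransport Ω t f x v‖₊ : ℝ≥0∞)
        ≤ C * g (x - t • v) v := by
    intro x hx v hv
    by_cases hlt : ENNReal.ofReal t < tminus Ω x v
    · have hy := sub_smul_mem_of_lt_tminus ht hlt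
      have hone : 1 ≤ C * ENNReal.ofReal (max 1 (‖v‖⁻¹ ^ k)) := by
        have hD : 0 ≤ (Metric.diam Ω / t) ^ k :=
          pow_nonneg (div_nonneg Metric.diam_nonneg ht.le) k
        rw [← ENNReal.ofReal_mul hD, ENNReal.one_le_ofReal]
        exact (one_le_diam_div_pow_mul_inv_norm_pow hΩbdd ht hv hx hy k).trans
          (mul_le_mul_of_nonneg_left (le_max_right _ _) hD)
      simp only [g, w, indicator_of_mem hy, freeTransport, if_pos hlt, pow_zero, max_self,
        ENNReal.ofReal_one]
      rw [← mul_assoc]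
      exact mul_le_mul_left hone _
    · simp [freeTransport, hlt]
  calc Xnorm Ω m 0 (freeTransport Ω t f)
      ≤ ∫⁻ x in Ω, ∫⁻ v, C * g (x - t • v) v ∂m :=
        setLIntegral_mono' hΩopen.measurableSet fun x hx =>
          lintegral_mono_ae (hv0.mono fun v hv => hpoint x hx v hv)
    _ ≤ ∫⁻ x, ∫⁻ v, C * g (x - t • v) v ∂m := setLIntegral_le_lintegral _ _
    _ = ∫⁻ x, ∫⁻ v, C * g x v ∂m :=
        lintegral_lintegral_sub_smul volume m t (g := fun x v => C * g x v) (hg.const_mul C)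
    _ = C * ∫⁻ x, ∫⁻ v, g x v ∂m := by
        simp_rw [lintegral_const_mul' C _ ENNReal.ofReal_ne_top]
    _ = C * Xnorm Ω m k f := by
        congr 1
        rw [Xnorm, ← lintegral_indicator hΩopen.measurableSet]
        refine lintegral_congr fun x => ?_
        by_cases hx : x ∈ Ω <;> simp [g, w, hx]
end

section
/- Let k ∈ ℕ and let f : ℝ^d × ℝ^d → ℂ be measurable with ‖f‖_{X_{k+1}} < ∞. Then: (i) lim_{ε→0⁺} sup_{η∈ℝ} ‖D^k_{ε,η} f − D^k_{0,η} f‖_{X₀} = 0, and (ii) ‖D^k_{0,η} f‖_{X₀} → 0 as |η| → ∞. In particular the map η ↦ R(iη, T₀)f = D^0_{0,η} f, together with its η-derivatives up to order k (given by (−i)^j D^j_{0,η} f), vanishes in X₀ at infinity. -/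
open MeasureTheory Set Filter
open scoped ENNReal NNReal Topology

/-- The `k`-th derivative kernel of the resolvent of the free transport operator:
`(D^k_{ε,η} f)(x,v) = ∫₀^{t₋(x,v)} t^k e^{-(ε+iη)t} f(x - t v, v) dt`; for `k = 0` this is
the resolvent `R(ε+iη, T₀)f` with absorbing boundary conditions. -/
noncomputable def resKer {d : ℕ} (Ω : Set (EuclideanSpace ℝ (Fin d))) (k : ℕ) (ε η : ℝ)
    (f : EuclideanSpace ℝ (Fin d) → EuclideanSpace ℝ (Fin d) → ℂ)
    (x v : EuclideanSpace ℝ (Fin d)) : ℂ :=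
  ∫ t in {t : ℝ | 0 < t ∧ ENNReal.ofReal t < tminus Ω x v},
    (t : ℂ) ^ k * Complex.exp (-((ε : ℂ) + (η : ℂ) * Complex.I) * (t : ℂ)) * f (x - t • v) v

/-- The set of `((x, v), t)` such that `t > 0` and the backward trajectory issued from `(x, v)`
stays in `Ω` on the time interval `[0, t]`. -/
def backwardSet {d : ℕ} (Ω : Set (EuclideanSpace ℝ (Fin d))) :
    Set ((EuclideanSpace ℝ (Fin d) × EuclideanSpace ℝ (Fin d)) × ℝ) :=
  {p | 0 < p.2 ∧ ∀ u ∈ Icc (0 : ℝ) 1, p.1.1 - (p.2 * u) • p.1.2 ∈ Ω}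

/-- The function `t ^ k * f (x - t • v) v`, extended by zero outside `backwardSet Ω`. -/
noncomputable def backwardIntegrand {d : ℕ} (Ω : Set (EuclideanSpace ℝ (Fin d))) (k : ℕ)
    (f : EuclideanSpace ℝ (Fin d) → EuclideanSpace ℝ (Fin d) → ℂ) :
    (EuclideanSpace ℝ (Fin d) × EuclideanSpace ℝ (Fin d)) × ℝ → ℂ :=
  (backwardSet Ω).indicator fun p => (p.2 : ℂ) ^ k * f (p.1.1 - p.2 • p.1.2) p.1.2

section

variable {d : ℕ} {Ω : Set (EuclideanSpace ℝ (Fin d))}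

theorem isOpen_backwardSet (hΩ : IsOpen Ω) : IsOpen (backwardSet Ω) := by
  refine (isOpen_lt continuous_const continuous_snd).inter (isOpen_iff_mem_nhds.2 fun p hp => ?_)
  refine isCompact_Icc.eventually_forall_of_forall_eventually fun u hu => ?_
  have hc : Continuous fun z : ((EuclideanSpace ℝ (Fin d) × EuclideanSpace ℝ (Fin d)) × ℝ) × ℝ =>
      z.1.1.1 - (z.1.2 * z.2) • z.1.1.2 := by fun_prop
  exact hc.continuousAt.eventually (hΩ.mem_nhds (hp u hu))

theorem mem_backwardSet_iff (hΩ : IsOpen Ω) {x v : EuclideanSpace ℝ (Fin d)} (hx : x ∈ Ω)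
    (t : ℝ) : ((x, v), t) ∈ backwardSet Ω ↔ 0 < t ∧ ENNReal.ofReal t < tminus Ω x v := by
  refine and_congr_right fun ht => ⟨fun h => ?_, fun h u hu => ?_⟩
  · have hc : Continuous fun s : ℝ => x - s • v := by fun_prop
    have hmem : x - t • v ∈ Ω := by simpa using h 1 (by simp)
    obtain ⟨δ, hδ, hball⟩ := Metric.mem_nhds_iff.1 (hc.continuousAt.eventually (hΩ.mem_nhds hmem))
    refine ((ENNReal.ofReal_lt_ofReal_iff (by linarith)).2 (lt_add_of_pos_right t hδ)).trans_le ?_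
    refine le_iInf₂ fun s hs => ENNReal.ofReal_le_ofReal ?_
    by_contra! hlt
    rcases le_or_gt s t with hst | hst
    · have := h (s / t) ⟨div_nonneg hs.1.le ht.le, (div_le_one ht).2 hst⟩
      rw [mul_div_cancel₀ _ ht.ne'] at this
      exact hs.2 this
    · refine hs.2 (hball ?_)
      rw [Metric.mem_ball, Real.dist_eq, abs_lt]
      constructor <;> linarith
  · by_contra hn
    have hu0 : 0 < u := by
      refine hu.1.lt_of_ne ?_
      rintro rfl
      exact hn (by simpa using hx)
    refine h.not_ge ((iInf₂_le (t * u) ⟨mul_pos ht hu0, hn⟩).trans (ENNReal.ofReal_le_ofReal ?_))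
    exact mul_le_of_le_one_right ht.le hu.2

theorem measurable_backwardIntegrand (hΩ : IsOpen Ω) (k : ℕ)
    {f : EuclideanSpace ℝ (Fin d) → EuclideanSpace ℝ (Fin d) → ℂ}
    (hf : Measurable (Function.uncurry f)) : Measurable (backwardIntegrand Ω k f) := by
  refine Measurable.indicator ?_ (isOpen_backwardSet hΩ).measurableSet
  refine Measurable.mul (by fun_prop) ?_
  exact hf.comp (f := fun p : (EuclideanSpace ℝ (Fin d) × EuclideanSpace ℝ (Fin d)) × ℝ =>
    (p.1.1 - p.2 • p.1.2, p.1.2)) (by fun_prop)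

theorem resKer_eq_integral_backwardIntegrand (hΩ : IsOpen Ω) (k : ℕ) (ε η : ℝ)
    (f : EuclideanSpace ℝ (Fin d) → EuclideanSpace ℝ (Fin d) → ℂ)
    {x : EuclideanSpace ℝ (Fin d)} (hx : x ∈ Ω) (v : EuclideanSpace ℝ (Fin d)) :
    resKer Ω k ε η f x v = ∫ t : ℝ, Complex.exp (-((ε : ℂ) + (η : ℂ) * Complex.I) * (t : ℂ)) *
      backwardIntegrand Ω k f ((x, v), t) := by
  have hS : {t : ℝ | 0 < t ∧ ENNReal.ofReal t < tminus Ω x v} =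
      (fun t : ℝ => ((x, v), t)) ⁻¹' backwardSet Ω := by
    ext t
    exact (mem_backwardSet_iff hΩ hx t).symm
  have hSm : MeasurableSet ((fun t : ℝ => ((x, v), t)) ⁻¹' backwardSet Ω) :=
    measurable_prodMk_left (isOpen_backwardSet hΩ).measurableSet
  rw [resKer, hS, ← integral_indicator hSm]
  refine integral_congr_ae (ae_of_all _ fun t => ?_)
  by_cases ht : ((x, v), t) ∈ backwardSet Ω
  · beta_reduce
    rw [backwardIntegrand, indicator_of_mem ht,
      indicator_of_mem (s := (fun t : ℝ => ((x, v), t)) ⁻¹' backwardSet Ω) ht]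
    ring
  · simp [backwardIntegrand, ht]

theorem tendsto_integral_exp_mul_cocompact (g : ℝ → ℂ) :
    Tendsto (fun η : ℝ => ∫ t : ℝ, Complex.exp (-(((0 : ℝ) : ℂ) + (η : ℂ) * Complex.I) * (t : ℂ)) *
      g t) (cocompact ℝ) (𝓝 0) := by
  have h2π : (2 * Real.pi)⁻¹ ≠ 0 := by positivity
  have := (Real.tendsto_integral_exp_smul_cocompact g).comp
    (Homeomorph.mulRight₀ _ h2π).isClosedEmbedding.tendsto_cocompact
  refine this.congr fun η => integral_congr_ae (ae_of_all _ fun t => ?_)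
  simp only [Homeomorph.coe_mulRight₀, Circle.smul_def, Real.fourierChar_apply, smul_eq_mul]
  congr 2
  have : (Real.pi : ℂ) ≠ 0 := by exact_mod_cast Real.pi_ne_zero
  push_cast
  field_simp
  ring

theorem norm_exp_neg_mul_le_one {ε : ℝ} (hε : 0 ≤ ε) (η : ℝ) {t : ℝ} (ht : 0 ≤ t) :
    ‖Complex.exp (-((ε : ℂ) + (η : ℂ) * Complex.I) * (t : ℂ))‖ ≤ 1 := by
  rw [Complex.norm_exp]
  simp
  positivity

theorem setLIntegral_pow_le (Ω : Set (EuclideanSpace ℝ (Fin d))) (hΩ : Bornology.IsBounded Ω)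
    (k : ℕ) {y v : EuclideanSpace ℝ (Fin d)} (hy : y ∈ Ω) (hv : v ≠ 0) :
    ∫⁻ t in {t : ℝ | 0 < t ∧ y + t • v ∈ Ω}, ENNReal.ofReal (t ^ k) ≤
      ENNReal.ofReal (Metric.diam Ω ^ (k + 1)) * ENNReal.ofReal (max 1 (‖v‖⁻¹ ^ (k + 1))) := by
  have hv' : 0 < ‖v‖ := norm_pos_iff.2 hv
  have hD : 0 ≤ Metric.diam Ω := Metric.diam_nonneg
  set T := Metric.diam Ω * ‖v‖⁻¹ with hT
  have hT0 : 0 ≤ T := by positivity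
  have hsub : {t : ℝ | 0 < t ∧ y + t • v ∈ Ω} ⊆ Ioc 0 T := by
    rintro t ⟨ht, hyt⟩
    refine ⟨ht, ?_⟩
    have := Metric.dist_le_diam_of_mem hΩ hyt hy
    rw [dist_eq_norm, add_sub_cancel_left, norm_smul, Real.norm_of_nonneg ht.le] at this
    rwa [hT, ← div_eq_mul_inv, le_div_iff₀ hv']
  calc ∫⁻ t in {t : ℝ | 0 < t ∧ y + t • v ∈ Ω}, ENNReal.ofReal (t ^ k)
      ≤ ∫⁻ t in Ioc 0 T, ENNReal.ofReal (t ^ k) := lintegral_mono_set hsub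
    _ ≤ ∫⁻ t in Ioc 0 T, ENNReal.ofReal (T ^ k) := by
        refine setLIntegral_mono measurable_const fun t ht => ENNReal.ofReal_le_ofReal ?_
        exact pow_le_pow_left₀ ht.1.le ht.2 k
    _ = ENNReal.ofReal (T ^ (k + 1)) := by
        rw [setLIntegral_const, Real.volume_Ioc, sub_zero, ← ENNReal.ofReal_mul (by positivity),
          pow_succ]
    _ ≤ _ := by
        rw [← ENNReal.ofReal_mul (by positivity), hT, mul_pow]
        gcongr
        exact le_max_right _ _

theorem lintegral_enorm_backwardIntegrand_lt_top (hΩ : IsOpen Ω) (hΩb : Bornology.IsBounded Ω)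
    (m : Measure (EuclideanSpace ℝ (Fin d))) [SigmaFinite m] (hm0 : m {0} = 0) (k : ℕ)
    {f : EuclideanSpace ℝ (Fin d) → EuclideanSpace ℝ (Fin d) → ℂ}
    (hf : Measurable (Function.uncurry f)) (hfX : Xnorm Ω m (k + 1) f < ⊤) :
    ∫⁻ p, ‖backwardIntegrand Ω k f p‖ₑ ∂(((volume.restrict Ω).prod m).prod volume) < ⊤ := by
  let B : Set ((EuclideanSpace ℝ (Fin d) × EuclideanSpace ℝ (Fin d)) × ℝ) :=
    {p | p.1.1 ∈ Ω ∧ 0 < p.2 ∧ p.1.1 + p.2 • p.1.2 ∈ Ω}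
  let h : (EuclideanSpace ℝ (Fin d) × EuclideanSpace ℝ (Fin d)) × ℝ → ℝ≥0∞ :=
    B.indicator fun p => ENNReal.ofReal (p.2 ^ k) * ‖f p.1.1 p.1.2‖ₑ
  have hB : MeasurableSet B := by
    have h1 : IsOpen B := by
      refine (hΩ.preimage (by fun_prop)).inter
        ((isOpen_lt continuous_const continuous_snd).inter (hΩ.preimage (by fun_prop)))
    exact h1.measurableSet
  have hf' : Measurable fun p : (EuclideanSpace ℝ (Fin d) × EuclideanSpace ℝ (Fin d)) × ℝ =>
      f p.1.1 p.1.2 := hf.comp measurable_fst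
  have hh : Measurable h := Measurable.indicator (by fun_prop) hB
  have hle (x v : EuclideanSpace ℝ (Fin d)) (t : ℝ) :
      ‖backwardIntegrand Ω k f ((x, v), t)‖ₑ ≤ h ((x - t • v, v), t) := by
    by_cases hp : ((x, v), t) ∈ backwardSet Ω
    · have hpB : ((x - t • v, v), t) ∈ B :=
        ⟨by simpa using hp.2 1 (by simp), hp.1, by simpa using hp.2 0 (by simp)⟩
      simp only [h, backwardIntegrand, indicator_of_mem hp, indicator_of_mem hpB, enorm_mul]
      gcongr
      rw [← ofReal_norm, norm_pow, Complex.norm_real, Real.norm_of_nonneg hp.1.le]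
    · simp [backwardIntegrand, hp]
  have hswap (μ : Measure (EuclideanSpace ℝ (Fin d))) [SFinite μ]
      {F : (EuclideanSpace ℝ (Fin d) × EuclideanSpace ℝ (Fin d)) × ℝ → ℝ≥0∞}
      (hF : Measurable F) : ∫⁻ p, F p ∂((μ.prod m).prod volume) =
        ∫⁻ t : ℝ, ∫⁻ v, (∫⁻ x, F ((x, v), t) ∂μ) ∂m := by
    rw [lintegral_prod_symm' _ hF]
    exact lintegral_congr fun t => lintegral_prod_symm' _ (hF.comp measurable_prodMk_right)
  have htrans (v : EuclideanSpace ℝ (Fin d)) (t : ℝ) :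
      ∫⁻ x, h ((x - t • v, v), t) = ∫⁻ x, h ((x, v), t) :=
    lintegral_sub_right_eq_self (fun x => h ((x, v), t)) (t • v)
  set C := ENNReal.ofReal (Metric.diam Ω ^ (k + 1))
  have hv0 : ∀ᵐ v ∂m, v ≠ 0 := by
    rw [ae_iff]
    simpa using hm0
  have hinner (x : EuclideanSpace ℝ (Fin d)) {v : EuclideanSpace ℝ (Fin d)} (hv : v ≠ 0) :
      ∫⁻ t, h ((x, v), t) ≤
        C * (ENNReal.ofReal (max 1 (‖v‖⁻¹ ^ (k + 1))) * (‖f x v‖₊ : ℝ≥0∞)) := by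
    by_cases hx : x ∈ Ω
    · have hS : MeasurableSet {t : ℝ | 0 < t ∧ x + t • v ∈ Ω} :=
        ((isOpen_lt continuous_const continuous_id).inter
          (hΩ.preimage (f := fun t : ℝ => x + t • v) (by fun_prop))).measurableSet
      calc ∫⁻ t, h ((x, v), t)
          = ∫⁻ t in {t : ℝ | 0 < t ∧ x + t • v ∈ Ω}, ENNReal.ofReal (t ^ k) * ‖f x v‖ₑ := by
            rw [← lintegral_indicator hS]
            refine lintegral_congr fun t => ?_
            by_cases ht : 0 < t ∧ x + t • v ∈ Ω
            · have hxt : ((x, v), t) ∈ B := ⟨hx, ht⟩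
              simp only [h, indicator_of_mem hxt]
              exact (indicator_of_mem (s := {t : ℝ | 0 < t ∧ x + t • v ∈ Ω}) ht
                fun t => ENNReal.ofReal (t ^ k) * ‖f x v‖ₑ).symm
            · have hxt : ((x, v), t) ∉ B := fun hB => ht hB.2
              simp only [h, indicator_of_notMem hxt]
              exact (indicator_of_notMem (s := {t : ℝ | 0 < t ∧ x + t • v ∈ Ω}) ht
                fun t => ENNReal.ofReal (t ^ k) * ‖f x v‖ₑ).symm
        _ = (∫⁻ t in {t : ℝ | 0 < t ∧ x + t • v ∈ Ω}, ENNReal.ofReal (t ^ k)) * ‖f x v‖ₑ :=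
            lintegral_mul_const _ (by fun_prop)
        _ ≤ _ := by
            rw [← mul_assoc]
            exact mul_le_mul_left (setLIntegral_pow_le Ω hΩb k hx hv) _
    · simp [h, B, hx]
  calc ∫⁻ p, ‖backwardIntegrand Ω k f p‖ₑ ∂(((volume.restrict Ω).prod m).prod volume)
      = ∫⁻ t : ℝ, ∫⁻ v, (∫⁻ x in Ω, ‖backwardIntegrand Ω k f ((x, v), t)‖ₑ) ∂m :=
        hswap _ (measurable_backwardIntegrand hΩ k hf).enorm
    _ ≤ ∫⁻ t : ℝ, ∫⁻ v, (∫⁻ x, h ((x, v), t)) ∂m := by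
        refine lintegral_mono fun t => lintegral_mono fun v => ?_
        rw [← htrans]
        exact (setLIntegral_le_lintegral _ _).trans (lintegral_mono fun x => hle x v t)
    _ = ∫⁻ x, ∫⁻ v, (∫⁻ t, h ((x, v), t)) ∂m := by
        rw [← hswap volume hh, lintegral_prod _ hh.aemeasurable,
          lintegral_prod _ hh.lintegral_prod_right'.aemeasurable]
    _ = ∫⁻ x in Ω, ∫⁻ v, (∫⁻ t, h ((x, v), t)) ∂m := by
        rw [← lintegral_indicator hΩ.measurableSet]
        refine lintegral_congr fun x => ?_
        by_cases hx : x ∈ Ω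
        · simp [hx]
        · simp [h, B, hx]
    _ ≤ ∫⁻ x in Ω, C * ∫⁻ v, ENNReal.ofReal (max 1 (‖v‖⁻¹ ^ (k + 1))) * (‖f x v‖₊ : ℝ≥0∞) ∂m := by
        refine lintegral_mono fun x => ?_
        rw [← lintegral_const_mul' _ _ ENNReal.ofReal_ne_top]
        exact lintegral_mono_ae (hv0.mono fun v hv => hinner x hv)
    _ = C * Xnorm Ω m (k + 1) f := lintegral_const_mul' _ _ ENNReal.ofReal_ne_top
    _ < ⊤ := ENNReal.mul_lt_top ENNReal.ofReal_lt_top hfX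

theorem Xnorm_zero_eq_lintegral_prod (hΩ : IsOpen Ω) (m : Measure (EuclideanSpace ℝ (Fin d)))
    [SFinite m] {g : EuclideanSpace ℝ (Fin d) → EuclideanSpace ℝ (Fin d) → ℂ}
    {G : EuclideanSpace ℝ (Fin d) × EuclideanSpace ℝ (Fin d) → ℂ} (hG : Measurable G)
    (hgG : ∀ x ∈ Ω, ∀ v, g x v = G (x, v)) :
    Xnorm Ω m 0 g = ∫⁻ q, ‖G q‖ₑ ∂((volume.restrict Ω).prod m) := by
  rw [lintegral_prod _ hG.enorm.aemeasurable]
  refine setLIntegral_congr_fun hΩ.measurableSet fun x hx => lintegral_congr fun v => ?_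
  simp [hgG x hx v, enorm_eq_nnnorm]

end

/-- For `f ∈ X_{k+1}`: (i) `D^k_{ε,η} f → D^k_{0,η} f` in `X₀` as `ε → 0⁺`, uniformly in
`η ∈ ℝ`, and (ii) `‖D^k_{0,η} f‖_{X₀} → 0` as `|η| → ∞`. -/
theorem resKer_boundary_and_riemannLebesgue {d : ℕ} (hd : 1 ≤ d)
    (Ω : Set (EuclideanSpace ℝ (Fin d))) (hΩopen : IsOpen Ω)
    (hΩne : Ω.Nonempty) (hΩbdd : Bornology.IsBounded Ω)
    (m : Measure (EuclideanSpace ℝ (Fin d))) [SigmaFinite m] (hm0 : m {0} = 0)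
    (k : ℕ)
    (f : EuclideanSpace ℝ (Fin d) → EuclideanSpace ℝ (Fin d) → ℂ)
    (hf : Measurable (Function.uncurry f))
    (hfX : Xnorm Ω m (k + 1) f < ⊤) :
    Filter.Tendsto
      (fun ε : ℝ => ⨆ η : ℝ, Xnorm Ω m 0 (fun x v => resKer Ω k ε η f x v - resKer Ω k 0 η f x v))
      (nhdsWithin 0 (Set.Ioi 0)) (nhds 0) ∧
    Filter.Tendsto (fun η : ℝ => Xnorm Ω m 0 (resKer Ω k 0 η f))
      (Filter.cocompact ℝ) (nhds 0) := by
  set μ := (volume.restrict Ω).prod m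
  set W := backwardIntegrand Ω k f
  have hWm : Measurable W := measurable_backwardIntegrand hΩopen k hf
  have hWfin : ∫⁻ p, ‖W p‖ₑ ∂(μ.prod volume) < ⊤ :=
    lintegral_enorm_backwardIntegrand_lt_top hΩopen hΩbdd m hm0 k hf hfX
  have hWfin' : ∫⁻ q, (∫⁻ t : ℝ, ‖W (q, t)‖ₑ) ∂μ < ⊤ := by
    rwa [← lintegral_prod _ hWm.enorm.aemeasurable]
  have hWint : ∀ᵐ q ∂μ, Integrable fun t : ℝ => W (q, t) :=
    Integrable.prod_right_ae ⟨hWm.aestronglyMeasurable, hWfin⟩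
  have hWsupp (q) {t : ℝ} (ht : t ≤ 0) : W (q, t) = 0 :=
    indicator_of_notMem (fun h => ht.not_gt h.1) _
  let K : ℝ → ℝ → ℝ → ℂ := fun ε η t => Complex.exp (-((ε : ℂ) + (η : ℂ) * Complex.I) * (t : ℂ))
  have hKle {ε : ℝ} (hε : 0 ≤ ε) (η : ℝ) (q) (t : ℝ) : ‖K ε η t * W (q, t)‖ₑ ≤ ‖W (q, t)‖ₑ := by
    rcases le_total t 0 with ht | ht
    · simp [hWsupp q ht]
    · rw [enorm_le_iff_norm_le, norm_mul]
      exact mul_le_of_le_one_left (norm_nonneg _) (norm_exp_neg_mul_le_one hε η ht)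
  have hKm (ε η : ℝ) : Measurable fun t => K ε η t := by fun_prop
  have hG (ε η : ℝ) : Measurable fun q => ∫ t : ℝ, K ε η t * W (q, t) :=
    (StronglyMeasurable.integral_prod_right' (f := fun p => K ε η p.2 * W p)
      (((hKm ε η).comp measurable_snd).mul hWm).stronglyMeasurable).measurable
  have hres (ε η : ℝ) {x} (hx : x ∈ Ω) (v) :
      resKer Ω k ε η f x v = ∫ t : ℝ, K ε η t * W ((x, v), t) :=
    resKer_eq_integral_backwardIntegrand hΩopen k ε η f hx v
  constructor
  · have hlim : Tendsto (fun ε : ℝ => ∫⁻ p, ‖Real.exp (-(ε * p.2)) - 1‖ₑ * ‖W p‖ₑ ∂(μ.prod volume))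
        (𝓝[>] 0) (𝓝 (∫⁻ _, 0 ∂(μ.prod (volume : Measure ℝ)))) := by
      refine tendsto_lintegral_filter_of_dominated_convergence (fun p => ‖W p‖ₑ)
        (Eventually.of_forall fun ε => by fun_prop) ?_ hWfin.ne (ae_of_all _ fun p => ?_)
      · filter_upwards [self_mem_nhdsWithin] with ε hε
        refine ae_of_all _ fun p => ?_
        rcases le_total p.2 0 with ht | ht
        · simp [hWsupp p.1 ht]
        · refine mul_le_of_le_one_left zero_le ?_
          rw [← ofReal_norm, Real.norm_eq_abs, ENNReal.ofReal_le_one, abs_le]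
          have h1 := Real.exp_pos (-(ε * p.2))
          have h2 : Real.exp (-(ε * p.2)) ≤ 1 :=
            Real.exp_le_one_iff.2 (neg_nonpos.2 (mul_nonneg (le_of_lt hε) ht))
          constructor <;> linarith
      · have hc : Continuous fun ε : ℝ => ‖Real.exp (-(ε * p.2)) - 1‖ₑ := by fun_prop
        have h0 : Tendsto (fun ε : ℝ => ‖Real.exp (-(ε * p.2)) - 1‖ₑ) (𝓝[>] 0) (𝓝 0) := by
          simpa using (hc.tendsto 0).mono_left nhdsWithin_le_nhds
        simpa using ENNReal.Tendsto.mul_const h0 (Or.inr enorm_ne_top)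
    rw [lintegral_zero] at hlim
    refine tendsto_of_tendsto_of_tendsto_of_le_of_le' tendsto_const_nhds hlim
      (Eventually.of_forall fun _ => zero_le) ?_
    filter_upwards [self_mem_nhdsWithin] with ε hε
    refine iSup_le fun η => ?_
    rw [Xnorm_zero_eq_lintegral_prod hΩopen m ((hG ε η).sub (hG 0 η))
      fun x hx v => by simp [hres _ _ hx],
      lintegral_prod (μ := μ) _ (Measurable.aemeasurable (by fun_prop))]
    refine lintegral_mono_ae (hWint.mono fun q hq => ?_)
    have hint {δ : ℝ} (hδ : 0 ≤ δ) : Integrable fun t => K δ η t * W (q, t) :=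
      hq.mono (((hKm δ η).mul (hWm.comp measurable_prodMk_left)).aestronglyMeasurable)
        (ae_of_all _ fun t => enorm_le_iff_norm_le.1 (hKle hδ η q t))
    simp only [Pi.sub_apply]
    rw [← integral_sub (hint (le_of_lt hε)) (hint le_rfl)]
    refine (enorm_integral_le_lintegral_enorm _).trans (lintegral_mono fun t => le_of_eq ?_)
    have hfac : K ε η t = K 0 η t * (Real.exp (-(ε * t)) : ℂ) := by
      simp only [K]
      push_cast
      rw [← Complex.exp_add]
      congr 1
      ring
    have hK0 : ‖K 0 η t‖ = 1 := by
      simp [K, Complex.norm_exp]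
    rw [hfac, show K 0 η t * (Real.exp (-(ε * t)) : ℂ) * W (q, t) - K 0 η t * W (q, t) =
      K 0 η t * (((Real.exp (-(ε * t)) - 1 : ℝ) : ℂ) * W (q, t)) by push_cast; ring,
      ← ofReal_norm, norm_mul, hK0, one_mul, ofReal_norm, enorm_mul,
      ← ofReal_norm, Complex.norm_real, ofReal_norm]
  · have : (cocompact ℝ).IsCountablyGenerated := by
      rw [cocompact_eq_atBot_atTop]
      infer_instance
    have hlim : Tendsto (fun η : ℝ => ∫⁻ q, ‖∫ t : ℝ, K 0 η t * W (q, t)‖ₑ ∂μ) (cocompact ℝ)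
        (𝓝 (∫⁻ _, 0 ∂μ)) := by
      refine tendsto_lintegral_filter_of_dominated_convergence (fun q => ∫⁻ t : ℝ, ‖W (q, t)‖ₑ)
        (Eventually.of_forall fun η => (hG 0 η).enorm) (Eventually.of_forall fun η =>
          ae_of_all _ fun q => ?_) hWfin'.ne (ae_of_all _ fun q => ?_)
      · exact (enorm_integral_le_lintegral_enorm _).trans (lintegral_mono (hKle le_rfl η q))
      · have := (tendsto_integral_exp_mul_cocompact fun t => W (q, t)).enorm
        rwa [enorm_zero] at this
    rw [lintegral_zero] at hlim
    exact hlim.congr fun η =>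
      (Xnorm_zero_eq_lintegral_prod hΩopen m (hG 0 η) fun x hx v => hres 0 η hx v).symm
end

section
/- Let X be a complex Banach space, β > 0, C > 0, and let Θ : ℝ → X be Bochner integrable and satisfy: (a) ‖Θ(η₁) − Θ(η₂)‖ ≤ ω(|η₁ − η₂|) for all η₁, η₂ ∈ ℝ, where ω : [0,∞) → [0,∞); and (b) ∫_{|η| > R} ‖Θ(η)‖ dη ≤ C·R^{−β} for every R > 0. Then for every t ≥ 1 and every R > 2π one has ‖∫_ℝ e^{iηt} Θ(η) dη‖ ≤ 2R·ω(π/t) + 2^β·C·R^{−β}. -/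
open MeasureTheory

/-- Shifting the variable by `π / t` flips the sign of `exp (i η t)`, so twice the Fourier integral
is the Fourier integral of the difference of `Θ` and its translate. -/
theorem two_smul_integral_exp_smul_eq_integral_sub_translate {X : Type*} [NormedAddCommGroup X]
    [NormedSpace ℂ X] {Θ : ℝ → X} (hΘ : Integrable Θ) {t : ℝ} (ht : t ≠ 0) :
    (2 : ℂ) • ∫ η : ℝ, Complex.exp (Complex.I * (η : ℂ) * (t : ℂ)) • Θ η
      = ∫ η : ℝ, Complex.exp (Complex.I * (η : ℂ) * (t : ℂ)) • (Θ η - Θ (η + Real.pi / t)) := by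
  have integrable_exp_smul : ∀ f : ℝ → X, Integrable f →
      Integrable fun η : ℝ => Complex.exp (Complex.I * (η : ℂ) * (t : ℂ)) • f η := by
    intro f hf
    refine hf.bdd_smul 1 (Continuous.aestronglyMeasurable (by fun_prop)) (ae_of_all _ fun η => ?_)
    simp [Complex.norm_exp]
  have htr : ∫ η : ℝ, Complex.exp (Complex.I * (η : ℂ) * (t : ℂ)) • Θ η
      = -∫ η : ℝ, Complex.exp (Complex.I * (η : ℂ) * (t : ℂ)) • Θ (η + Real.pi / t) := by
    rw [← integral_add_right_eq_self _ (Real.pi / t), ← integral_neg]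
    congr 1 with η
    have harg : Complex.I * ((η + Real.pi / t : ℝ) : ℂ) * (t : ℂ)
        = Complex.I * (η : ℂ) * (t : ℂ) + Real.pi * Complex.I := by
      have : (t : ℂ) ≠ 0 := by exact_mod_cast ht
      push_cast
      field_simp
    rw [harg, Complex.exp_add, Complex.exp_pi_mul_I, mul_neg_one, neg_smul]
  simp only [smul_sub]
  rw [integral_sub (integrable_exp_smul _ hΘ) (integrable_exp_smul _ (hΘ.comp_add_right _)),
    two_smul, sub_eq_add_neg, ← htr]

/-- Quantitative decay of a vector-valued Fourier integral in terms of a modulus of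
continuity and tail decay: if `‖Θ(η₁) - Θ(η₂)‖ ≤ ω(|η₁ - η₂|)` and
`∫_{|η|>R} ‖Θ‖ ≤ C R^{-β}` for all `R > 0`, then for `t ≥ 1` and `R > 2π`,
`‖∫ e^{iηt} Θ(η) dη‖ ≤ 2 R ω(π/t) + 2^β C R^{-β}`. -/
theorem fourier_integral_modulus_bound {X : Type*} [NormedAddCommGroup X]
    [NormedSpace ℂ X] [CompleteSpace X]
    (β C : ℝ) (hβ : 0 < β) (hC : 0 < C)
    (Θ : ℝ → X) (hΘ : Integrable Θ)
    (ω : ℝ → ℝ) (hωnn : ∀ s : ℝ, 0 ≤ s → 0 ≤ ω s)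
    (hmod : ∀ η₁ η₂ : ℝ, ‖Θ η₁ - Θ η₂‖ ≤ ω |η₁ - η₂|)
    (htail : ∀ R : ℝ, 0 < R → (∫ η in {η : ℝ | R < |η|}, ‖Θ η‖) ≤ C * R ^ (-β))
    (t : ℝ) (ht : 1 ≤ t) (R : ℝ) (hR : 2 * Real.pi < R) :
    ‖∫ η : ℝ, Complex.exp (Complex.I * (η : ℂ) * (t : ℂ)) • Θ η‖
      ≤ 2 * R * ω (Real.pi / t) + 2 ^ β * C * R ^ (-β) := by
  have hpi := Real.pi_pos
  have ht0 : 0 < t := by linarith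
  have hR0 : 0 < R := by linarith
  set h := Real.pi / t
  have h_pos : 0 < h := by positivity
  have h_le : h ≤ Real.pi := div_le_self hpi.le ht
  have hω0 : 0 ≤ ω h := hωnn h h_pos.le
  have hmeas : MeasurableSet {η : ℝ | R / 2 < |η|} :=
    measurableSet_lt measurable_const measurable_id.abs
  set g : ℝ → ℝ := {η : ℝ | R / 2 < |η|}.indicator fun η => ‖Θ η‖ with hg
  have hg_int : Integrable g := hΘ.norm.indicator hmeas
  have hg_nonneg : ∀ η, 0 ≤ g η := Set.indicator_nonneg fun _ _ => norm_nonneg _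
  have hg_eq : ∀ η, R / 2 < |η| → g η = ‖Θ η‖ := fun η hη =>
    Set.indicator_of_mem (s := {η : ℝ | R / 2 < |η|}) hη _
  have hg_le : ∫ η, g η ≤ 2 ^ β * C * R ^ (-β) := by
    rw [hg, integral_indicator hmeas]
    refine (htail (R / 2) (by linarith)).trans_eq ?_
    rw [Real.div_rpow hR0.le (by norm_num), Real.rpow_neg (by norm_num : (0 : ℝ) ≤ 2)]
    field_simp
  set b : ℝ → ℝ := (Set.Icc (-R) R).indicator fun _ => ω h with hb
  have hb_int : Integrable b :=
    (integrableOn_const measure_Icc_lt_top.ne).integrable_indicator measurableSet_Icc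
  have hb_eq : ∫ η, b η = 2 * R * ω h := by
    rw [hb, integral_indicator measurableSet_Icc, setIntegral_const, Real.volume_real_Icc_of_le
      (by linarith), smul_eq_mul]
    ring
  have hpt : ∀ η : ℝ, ‖Complex.exp (Complex.I * (η : ℂ) * (t : ℂ)) • (Θ η - Θ (η + h))‖
      ≤ b η + (g η + g (η + h)) := by
    intro η
    have hnorm : ‖Complex.exp (Complex.I * (η : ℂ) * (t : ℂ))‖ = 1 := by simp [Complex.norm_exp]
    rw [norm_smul, hnorm, one_mul]
    by_cases hη : η ∈ Set.Icc (-R) R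
    · have hb' : b η = ω h := Set.indicator_of_mem hη _
      have hm := hmod η (η + h)
      rw [sub_add_cancel_left, abs_neg, abs_of_pos h_pos] at hm
      linarith [hg_nonneg η, hg_nonneg (η + h)]
    · have hb' : b η = 0 := Set.indicator_of_notMem hη _
      have hη' : R < |η| := by
        rwa [Set.mem_Icc, ← abs_le, not_le] at hη
      have hshift : R / 2 < |η + h| := by
        have := abs_sub_abs_le_abs_sub η (-h)
        rw [abs_neg, abs_of_pos h_pos, sub_neg_eq_add] at this
        linarith
      rw [hb', hg_eq η (by linarith), hg_eq _ hshift, zero_add]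
      exact norm_sub_le _ _
  have hg_sh : Integrable fun η => g (η + h) := hg_int.comp_add_right h
  have key := norm_integral_le_of_norm_le (hb_int.add (hg_int.add hg_sh)) (ae_of_all _ hpt)
  rw [← two_smul_integral_exp_smul_eq_integral_sub_translate hΘ ht0.ne', norm_smul,
    integral_add' hb_int (hg_int.add hg_sh), integral_add' hg_int hg_sh,
    integral_add_right_eq_self, hb_eq, Complex.norm_ofNat] at key
  have : 0 ≤ R * ω h := by positivity
  linarith
end

section
/- Let X be a complex Banach space, β > 0, C > 0, and let Θ : ℝ → X be Bochner integrable and satisfy: (a) ‖Θ(η₁) − Θ(η₂)‖ ≤ ω(|η₁ − η₂|) for all η₁, η₂ ∈ ℝ, where ω : [0,∞) → [0,∞) is nondecreasing with ω(s) → 0 as s → 0⁺; and (b) ∫_{|η| > R} ‖Θ(η)‖ dη ≤ C·R^{−β} for every R > 0. Then there exist K > 0, depending only on β and C, and t₀ ≥ 1 such that for all t ≥ t₀: ‖∫_ℝ e^{iηt} Θ(η) dη‖ ≤ K · ( ω(π/t) )^{β/(β+1)}. -/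
open MeasureTheory

/-- Translating by the half period `π / t` bounds a Fourier integral by an `L¹` increment. -/
theorem norm_fourier_integral_le_integral_norm_sub {X : Type*} [NormedAddCommGroup X]
    [NormedSpace ℂ X] {Θ : ℝ → X} (hΘ : Integrable Θ) {t : ℝ} (ht : t ≠ 0) :
    2 * ‖∫ η : ℝ, Complex.exp (Complex.I * (η : ℂ) * (t : ℂ)) • Θ η‖
      ≤ ∫ η : ℝ, ‖Θ η - Θ (η + Real.pi / t)‖ := by
  set f : ℝ → X := fun η => Complex.exp (Complex.I * (η : ℂ) * (t : ℂ)) • Θ η with hf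
  have hnorm (η : ℝ) : ‖Complex.exp (Complex.I * (η : ℂ) * (t : ℂ))‖ = 1 := by
    rw [Complex.norm_exp]; simp
  have hfi : Integrable f := by
    refine hΘ.bdd_smul (C := 1) ?_ ?_
    · exact Continuous.aestronglyMeasurable (by fun_prop)
    · exact Filter.Eventually.of_forall fun η => (hnorm η).le
  have hshift (η : ℝ) : f (η + Real.pi / t) =
      -(Complex.exp (Complex.I * (η : ℂ) * (t : ℂ)) • Θ (η + Real.pi / t)) := by
    have htc : (t : ℂ) ≠ 0 := by exact_mod_cast ht
    have harg : Complex.I * ((η + Real.pi / t : ℝ) : ℂ) * (t : ℂ)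
        = Complex.I * (η : ℂ) * (t : ℂ) + Real.pi * Complex.I := by
      push_cast
      field_simp
    simp only [hf]
    rw [harg, Complex.exp_add, Complex.exp_pi_mul_I]
    simp
  have hsum : (2 : ℝ) * ‖∫ η, f η‖ = ‖∫ η, (f η + f (η + Real.pi / t))‖ := by
    rw [integral_add hfi (hfi.comp_add_right _), integral_add_right_eq_self f, ← two_smul ℂ,
      norm_smul]
    simp
  rw [hsum]
  refine (norm_integral_le_integral_norm _).trans (le_of_eq ?_)
  congr 1
  ext η
  rw [hshift, hf, ← sub_eq_add_neg, ← smul_sub, norm_smul, hnorm, one_mul]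

/-- An `L¹` increment is at most the contribution of `[-R, R]` plus two tails. -/
theorem integral_norm_sub_translate_le {X : Type*} [NormedAddCommGroup X]
    {Θ : ℝ → X} (hΘ : Integrable Θ) {h R w : ℝ} (hh : 0 ≤ h) (hR : 2 * h ≤ R)
    (hw : ∀ η, ‖Θ η - Θ (η + h)‖ ≤ w) :
    ∫ η : ℝ, ‖Θ η - Θ (η + h)‖ ≤ 2 * R * w + (∫ η in {η : ℝ | R < |η|}, ‖Θ η‖)
      + ∫ η in {η : ℝ | R / 2 < |η|}, ‖Θ η‖ := by
  have hmeas (r : ℝ) : MeasurableSet {η : ℝ | r < |η|} :=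
    measurableSet_lt measurable_const measurable_norm
  set G : ℝ → ℝ → ℝ := fun r => {η : ℝ | r < |η|}.indicator fun η => ‖Θ η‖ with hG
  have hGi (r : ℝ) : Integrable (G r) := hΘ.norm.indicator (hmeas r)
  have hG0 (r η : ℝ) : 0 ≤ G r η := Set.indicator_nonneg (fun _ _ => norm_nonneg _) η
  set B : ℝ → ℝ := (Set.Icc (-R) R).indicator fun _ => w with hB
  have hBi : Integrable B :=
    (integrable_indicator_iff measurableSet_Icc).2 (integrableOn_const (by simp))
  have hGv (r : ℝ) : ∫ η, G r η = ∫ η in {η : ℝ | r < |η|}, ‖Θ η‖ :=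
    integral_indicator (hmeas r)
  have hBv : ∫ η, B η = 2 * R * w := by
    rw [hB, integral_indicator measurableSet_Icc, setIntegral_const, smul_eq_mul,
      Real.volume_real_Icc_of_le (by linarith)]
    ring
  have hpoint (η : ℝ) : ‖Θ η - Θ (η + h)‖ ≤ B η + G R η + G (R / 2) (η + h) := by
    by_cases hη : η ∈ Set.Icc (-R) R
    · have : B η = w := Set.indicator_of_mem hη _
      linarith [hw η, hG0 R η, hG0 (R / 2) (η + h)]
    · have hlt : R < |η| := by
        by_contra! hle
        exact hη (abs_le.1 hle)
      have hlt' : R / 2 < |η + h| := by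
        have := abs_sub (η + h) h
        rw [add_sub_cancel_right, abs_of_nonneg hh] at this
        linarith
      have h1 : B η = 0 := Set.indicator_of_notMem hη _
      have h2 : G R η = ‖Θ η‖ := Set.indicator_of_mem (s := {η : ℝ | R < |η|}) hlt _
      have h3 : G (R / 2) (η + h) = ‖Θ (η + h)‖ :=
        Set.indicator_of_mem (s := {η : ℝ | R / 2 < |η|}) hlt' _
      rw [h1, h2, h3, zero_add]
      exact norm_sub_le _ _
  have hBG : Integrable fun η => B η + G R η := hBi.add (hGi R)
  have hGs : Integrable fun η => G (R / 2) (η + h) := (hGi (R / 2)).comp_add_right h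
  calc ∫ η : ℝ, ‖Θ η - Θ (η + h)‖
      ≤ ∫ η, (B η + G R η + G (R / 2) (η + h)) :=
        integral_mono (hΘ.sub (hΘ.comp_add_right h)).norm (hBG.add hGs) hpoint
    _ = _ := by
        rw [integral_add hBG hGs, integral_add hBi (hGi R),
          integral_add_right_eq_self (G (R / 2)), hBv, hGv, hGv]

/-- Decay of a vector-valued Fourier integral with rate given by a power of the modulus
of continuity: there is `K > 0` depending only on `β` and `C` such that for every
integrable `Θ` with modulus of continuity `ω` (nondecreasing, vanishing at `0⁺`) and tail
decay `∫_{|η|>R} ‖Θ‖ ≤ C R^{-β}`, there is `t₀ ≥ 1` with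
`‖∫ e^{iηt} Θ(η) dη‖ ≤ K (ω(π/t))^{β/(β+1)}` for all `t ≥ t₀`. -/
theorem fourier_integral_modulus_decay {X : Type*} [NormedAddCommGroup X]
    [NormedSpace ℂ X] [CompleteSpace X]
    (β C : ℝ) (hβ : 0 < β) (hC : 0 < C) :
    ∃ K : ℝ, 0 < K ∧
      ∀ (Θ : ℝ → X) (ω : ℝ → ℝ),
        Integrable Θ →
        (∀ s : ℝ, 0 ≤ s → 0 ≤ ω s) →
        MonotoneOn ω (Set.Ici 0) →
        Filter.Tendsto ω (nhdsWithin 0 (Set.Ioi 0)) (nhds 0) →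
        (∀ η₁ η₂ : ℝ, ‖Θ η₁ - Θ η₂‖ ≤ ω |η₁ - η₂|) →
        (∀ R : ℝ, 0 < R → (∫ η in {η : ℝ | R < |η|}, ‖Θ η‖) ≤ C * R ^ (-β)) →
        ∃ t₀ : ℝ, 1 ≤ t₀ ∧ ∀ t : ℝ, t₀ ≤ t →
          ‖∫ η : ℝ, Complex.exp (Complex.I * (η : ℂ) * (t : ℂ)) • Θ η‖
            ≤ K * ω (Real.pi / t) ^ (β / (β + 1)) := by
  refine ⟨2 + C * (1 + 2 ^ β), by positivity, ?_⟩
  intro Θ ω hΘ hω0 _ hωlim hmod htail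
  have hsmall : ∀ᶠ t : ℝ in Filter.atTop, ω (Real.pi / t) < 2 ^ (-(β + 1)) := by
    have hlim : Filter.Tendsto (fun t : ℝ => Real.pi / t) Filter.atTop
        (nhdsWithin 0 (Set.Ioi 0)) :=
      tendsto_nhdsWithin_iff.2 ⟨tendsto_const_nhds.div_atTop Filter.tendsto_id,
        (Filter.eventually_gt_atTop 0).mono fun t ht => div_pos Real.pi_pos ht⟩
    exact (hωlim.comp hlim).eventually_lt_const (by positivity)
  obtain ⟨t₁, ht₁⟩ := Filter.eventually_atTop.1 hsmall
  refine ⟨max t₁ Real.pi, le_max_of_le_right (by linarith [Real.pi_gt_three]), fun t ht => ?_⟩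
  have htpi : Real.pi ≤ t := (le_max_right _ _).trans ht
  have ht0 : 0 < t := Real.pi_pos.trans_le htpi
  have hwsmall := ht₁ t ((le_max_left _ _).trans ht)
  set h := Real.pi / t with hh
  have hh0 : 0 ≤ h := (div_pos Real.pi_pos ht0).le
  have hh1 : h ≤ 1 := (div_le_one ht0).2 htpi
  have hdiff (η : ℝ) : ‖Θ η - Θ (η + h)‖ ≤ ω h := by
    simpa [abs_of_nonneg hh0] using hmod η (η + h)
  have hF := norm_fourier_integral_le_integral_norm_sub hΘ ht0.ne'
  rw [← hh] at hF
  have hβ1 : 0 < β + 1 := by linarith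
  rcases (hω0 h hh0).eq_or_lt with hw | hw
  · have hz (η : ℝ) : ‖Θ η - Θ (η + h)‖ = 0 :=
      le_antisymm (hw ▸ hdiff η) (norm_nonneg _)
    simp only [hz, integral_zero] at hF
    rw [← hw, Real.zero_rpow (div_pos hβ hβ1).ne']
    linarith
  · set R := ω h ^ (-(1 / (β + 1))) with hR
    have hR0 : 0 < R := Real.rpow_pos_of_pos hw _
    have hR2 : 2 ≤ R := by
      have := Real.rpow_le_rpow_of_nonpos hw hwsmall.le
        (z := -(1 / (β + 1))) (neg_nonpos.2 (by positivity))
      rwa [← Real.rpow_mul (by norm_num), neg_mul_neg, mul_one_div_cancel hβ1.ne',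
        Real.rpow_one] at this
    have hRw : R * ω h = ω h ^ (β / (β + 1)) := by
      rw [hR, ← Real.rpow_add_one hw.ne']
      congr 1
      field_simp
      ring
    have hRβ : R ^ (-β) = ω h ^ (β / (β + 1)) := by
      rw [hR, ← Real.rpow_mul hw.le]
      congr 1
      field_simp
    have hRβ2 : (R / 2) ^ (-β) = 2 ^ β * ω h ^ (β / (β + 1)) := by
      rw [Real.div_rpow hR0.le (by norm_num), hRβ, Real.rpow_neg (by norm_num), div_inv_eq_mul,
        mul_comm]
    have hI := integral_norm_sub_translate_le hΘ hh0 (by linarith : 2 * h ≤ R) hdiff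
    have hT := htail R hR0
    have hT2 := htail (R / 2) (by positivity)
    rw [hRβ] at hT
    rw [hRβ2] at hT2
    have hnn := norm_nonneg (∫ η : ℝ, Complex.exp (Complex.I * (η : ℂ) * (t : ℂ)) • Θ η)
    rw [mul_assoc, hRw] at hI
    linarith
end

section
/- (Local form of the C^{1,α} normal estimate.) Let d ≥ 2, α ∈ (0,1], let U ⊆ ℝ^{d−1} be a convex open set, and let Φ : U → ℝ be differentiable with α-Hölder gradient: ‖∇Φ(u₁) − ∇Φ(u₂)‖ ≤ C_Φ ‖u₁ − u₂‖^α for all u₁, u₂ ∈ U. For u₀, u ∈ U set x := (u₀, Φ(u₀)) ∈ ℝ^d, y := (u, Φ(u)) ∈ ℝ^d, and let n := (1 + ‖∇Φ(u₀)‖²)^{−1/2} · (∇Φ(u₀), −1) ∈ ℝ^d be the unit normal to the graph of Φ at x. Then |⟨x − y, n⟩| ≤ ( C_Φ/(1+α) ) · ‖x − y‖^{1+α}. -/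
open scoped RealInnerProductSpace

/-- Embedding of a point `(u, a) ∈ ℝ^{n} × ℝ` into `ℝ^{n+1}` with the Euclidean (L²)
product norm. -/
noncomputable def graphPoint (n : ℕ) (u : EuclideanSpace ℝ (Fin n)) (a : ℝ) :
    WithLp 2 (EuclideanSpace ℝ (Fin n) × ℝ) :=
  (WithLp.equiv 2 (EuclideanSpace ℝ (Fin n) × ℝ)).symm (u, a)

/-- First-order Taylor estimate for a function with Hölder continuous gradient on a convex set. -/
theorem abs_sub_sub_inner_gradient_le {E : Type*} [NormedAddCommGroup E] [InnerProductSpace ℝ E]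
    [CompleteSpace E] {U : Set E} (hU : Convex ℝ U) {Φ : E → ℝ} {G : E → E} {C α : ℝ}
    (hα : 0 < α) (hgrad : ∀ u ∈ U, HasGradientAt Φ (G u) u)
    (hG : ∀ u₁ ∈ U, ∀ u₂ ∈ U, ‖G u₁ - G u₂‖ ≤ C * ‖u₁ - u₂‖ ^ α)
    {x y : E} (hx : x ∈ U) (hy : y ∈ U) :
    |Φ y - Φ x - ⟪G x, y - x⟫| ≤ C / (1 + α) * ‖x - y‖ ^ (1 + α) := by
  set v := y - x with hv
  have hα1 : 0 < 1 + α := by linarith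
  have hmem : ∀ t ∈ Set.Icc (0 : ℝ) 1, x + t • v ∈ U := fun t ht =>
    hU.add_smul_sub_mem hx hy ht
  have hline : ∀ t : ℝ, HasDerivAt (fun s : ℝ => x + s • v) v t := fun t => by
    simpa using ((hasDerivAt_id t).smul_const v).const_add x
  have hderiv : ∀ t ∈ Set.Icc (0 : ℝ) 1,
      HasDerivAt (fun s : ℝ => Φ (x + s • v) - Φ x - s * ⟪G x, v⟫)
        (⟪G (x + t • v) - G x, v⟫) t := fun t ht => by
    have h := (hgrad _ (hmem t ht)).hasFDerivAt.comp_hasDerivAt t (hline t)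
    have h' := (h.sub_const (Φ x)).sub ((hasDerivAt_id t).mul_const ⟪G x, v⟫)
    rw [inner_sub_left]
    simp only [InnerProductSpace.toDual_apply_apply, one_mul] at h'
    exact h'
  have hB : ∀ t : ℝ, HasDerivAt
      (fun s : ℝ => C / (1 + α) * ‖v‖ ^ (1 + α) * s ^ (1 + α))
      (C * ‖v‖ ^ (1 + α) * t ^ α) t := fun t => by
    have h := (Real.hasDerivAt_rpow_const (x := t) (p := 1 + α) (Or.inr (by linarith))).const_mul
      (C / (1 + α) * ‖v‖ ^ (1 + α))
    refine h.congr_deriv ?_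
    rw [add_sub_cancel_left]
    field_simp
  have key := image_norm_le_of_norm_deriv_right_le_deriv_boundary
    (f := fun s : ℝ => Φ (x + s • v) - Φ x - s * ⟪G x, v⟫)
    (f' := fun t => ⟪G (x + t • v) - G x, v⟫) (a := 0) (b := 1)
    (fun t ht => (hderiv t ht).continuousAt.continuousWithinAt)
    (fun t ht => (hderiv t (Set.Ico_subset_Icc_self ht)).hasDerivWithinAt)
    (by simp [Real.zero_rpow hα1.ne']) hB
    (fun t ht => by
      refine (norm_inner_le_norm _ _).trans ?_
      have h := hG _ (hmem t (Set.Ico_subset_Icc_self ht)) x hx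
      rw [add_sub_cancel_left, norm_smul, Real.norm_of_nonneg ht.1,
        Real.mul_rpow ht.1 (norm_nonneg v)] at h
      refine (mul_le_mul_of_nonneg_right h (norm_nonneg v)).trans_eq ?_
      rw [Real.rpow_add_of_nonneg (norm_nonneg v) zero_le_one hα.le, Real.rpow_one]
      ring)
    (Set.right_mem_Icc.2 zero_le_one)
  rw [norm_sub_rev x y, ← hv]
  simpa [hv] using key

/-- Local form of the `C^{1,α}` normal estimate: if `Φ` has an `α`-Hölder gradient `G` on
the convex open set `U`, `x = (u₀, Φ u₀)`, `y = (u, Φ u)` are points on the graph of `Φ`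
and `n` is the unit normal to the graph at `x`, then
`|⟨x - y, n⟩| ≤ (C_Φ/(1+α)) ‖x - y‖^{1+α}`. -/
theorem holder_normal_estimate (n : ℕ) (hn : 1 ≤ n) (α : ℝ) (hα0 : 0 < α) (hα1 : α ≤ 1)
    (U : Set (EuclideanSpace ℝ (Fin n))) (hUconv : Convex ℝ U) (hUopen : IsOpen U)
    (Φ : EuclideanSpace ℝ (Fin n) → ℝ)
    (G : EuclideanSpace ℝ (Fin n) → EuclideanSpace ℝ (Fin n)) (CΦ : ℝ)
    (hgrad : ∀ u ∈ U, HasGradientAt Φ (G u) u)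
    (hHolder : ∀ u₁ ∈ U, ∀ u₂ ∈ U, ‖G u₁ - G u₂‖ ≤ CΦ * ‖u₁ - u₂‖ ^ α)
    (u₀ : EuclideanSpace ℝ (Fin n)) (hu₀ : u₀ ∈ U)
    (u : EuclideanSpace ℝ (Fin n)) (hu : u ∈ U) :
    |⟪graphPoint n u₀ (Φ u₀) - graphPoint n u (Φ u),
        (Real.sqrt (1 + ‖G u₀‖ ^ 2))⁻¹ • graphPoint n (G u₀) (-1)⟫|
      ≤ CΦ / (1 + α) * ‖graphPoint n u₀ (Φ u₀) - graphPoint n u (Φ u)‖ ^ (1 + α) := by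
  have hα : 0 < 1 + α := by linarith
  rcases eq_or_ne u₀ u with rfl | hne
  · simp [Real.zero_rpow hα.ne']
  have hpos : 0 < ‖u₀ - u‖ ^ α := Real.rpow_pos_of_pos (norm_pos_iff.2 (sub_ne_zero.2 hne)) α
  have hC : 0 ≤ CΦ :=
    nonneg_of_mul_nonneg_left ((norm_nonneg _).trans (hHolder u₀ hu₀ u hu)) hpos
  have hinner : ⟪graphPoint n u₀ (Φ u₀) - graphPoint n u (Φ u), graphPoint n (G u₀) (-1)⟫
      = Φ u - Φ u₀ - ⟪G u₀, u - u₀⟫ := by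
    simp only [graphPoint, WithLp.prod_inner_apply, WithLp.equiv_symm_apply, inner_sub_left,
      real_inner_comm _ (G u₀)]
    simp
    ring
  have hnorm : ‖u₀ - u‖ ≤ ‖graphPoint n u₀ (Φ u₀) - graphPoint n u (Φ u)‖ :=
    WithLp.norm_fst_le _ (graphPoint n u₀ (Φ u₀) - graphPoint n u (Φ u))
  have hsqrt : (Real.sqrt (1 + ‖G u₀‖ ^ 2))⁻¹ ≤ 1 :=
    inv_le_one_of_one_le₀ (Real.one_le_sqrt.2 (by nlinarith [sq_nonneg ‖G u₀‖]))
  rw [real_inner_smul_right, hinner, abs_mul, abs_of_nonneg (by positivity)]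
  calc _ ≤ |Φ u - Φ u₀ - ⟪G u₀, u - u₀⟫| := mul_le_of_le_one_left (abs_nonneg _) hsqrt
    _ ≤ CΦ / (1 + α) * ‖u₀ - u‖ ^ (1 + α) :=
      abs_sub_sub_inner_gradient_le hUconv hα0 hgrad hHolder hu₀ hu
    _ ≤ _ := by gcongr
end

section
/- (Uniform Riemann–Lebesgue lemma.) Let h : (0,∞) → ℂ be Lebesgue integrable. Then lim_{|η| → ∞} sup_{ε ∈ [0,1]} | ∫₀^∞ e^{−(ε + iη)s} h(s) ds | = 0; that is, for every δ > 0 there is R > 0 such that for all η ∈ ℝ with |η| ≥ R and all ε ∈ [0,1], |∫₀^∞ e^{−(ε+iη)s} h(s) ds| ≤ δ. -/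
open MeasureTheory
open Filter Topology

lemma norm_exp_neg_add_mul_I_mul (ε η s : ℝ) :
    ‖Complex.exp (-((ε : ℂ) + (η : ℂ) * Complex.I) * (s : ℂ))‖ = Real.exp (-(ε * s)) := by
  rw [Complex.norm_exp]
  simp

lemma integrableOn_exp_neg_add_mul_I_mul {h : ℝ → ℂ} (hInt : IntegrableOn h (Set.Ioi 0))
    {ε : ℝ} (hε : 0 ≤ ε) (η : ℝ) :
    IntegrableOn (fun s : ℝ => Complex.exp (-((ε : ℂ) + (η : ℂ) * Complex.I) * (s : ℂ)) * h s)
      (Set.Ioi 0) := by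
  refine Integrable.bdd_mul (c := 1) hInt (by fun_prop) ?_
  filter_upwards [ae_restrict_mem measurableSet_Ioi] with s hs
  rw [norm_exp_neg_add_mul_I_mul, Real.exp_le_one_iff, neg_nonpos]
  exact mul_nonneg hε (le_of_lt hs)

lemma tendsto_integral_exp_neg_add_mul_I_mul (h : ℝ → ℂ) (ε : ℝ) :
    Tendsto (fun η : ℝ => ∫ s in Set.Ioi (0 : ℝ),
      Complex.exp (-((ε : ℂ) + (η : ℂ) * Complex.I) * (s : ℂ)) * h s) (cocompact ℝ) (𝓝 0) := by
  have hscale : Tendsto (fun η : ℝ => η * (2 * Real.pi)⁻¹) (cocompact ℝ) (cocompact ℝ) :=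
    (Homeomorph.mulRight₀ (2 * Real.pi)⁻¹ (by positivity)).isClosedEmbedding.tendsto_cocompact
  refine ((Real.tendsto_integral_exp_smul_cocompact ((Set.Ioi (0 : ℝ)).indicator
    fun s : ℝ => Complex.exp (-((ε : ℂ) * s)) * h s)).comp hscale).congr fun η => ?_
  rw [Function.comp_apply, ← integral_indicator measurableSet_Ioi]
  refine integral_congr_ae (Eventually.of_forall fun s => ?_)
  by_cases hs : s ∈ Set.Ioi (0 : ℝ)
  · simp only [Set.indicator_of_mem hs, Circle.smul_def, Real.fourierChar_apply, smul_eq_mul]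
    rw [← mul_assoc, ← Complex.exp_add]
    congr 2
    have hpi : (Real.pi : ℂ) ≠ 0 := Complex.ofReal_ne_zero.mpr Real.pi_ne_zero
    push_cast
    field_simp
    ring
  · simp [Set.indicator_of_notMem hs]

lemma norm_exp_neg_add_mul_I_mul_sub (ε ε' η s : ℝ) :
    ‖Complex.exp (-((ε : ℂ) + (η : ℂ) * Complex.I) * (s : ℂ)) -
      Complex.exp (-((ε' : ℂ) + (η : ℂ) * Complex.I) * (s : ℂ))‖ =
      |Real.exp (-(ε * s)) - Real.exp (-(ε' * s))| := by
  have hsplit (a : ℝ) : Complex.exp (-((a : ℂ) + (η : ℂ) * Complex.I) * (s : ℂ)) =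
      (Real.exp (-(a * s)) : ℂ) * Complex.exp ((-(η * s) : ℝ) * Complex.I) := by
    push_cast
    rw [← Complex.exp_add]
    congr 1
    ring
  rw [hsplit, hsplit, ← sub_mul, norm_mul, Complex.norm_exp_ofReal_mul_I, mul_one,
    ← Complex.ofReal_sub, Complex.norm_real, Real.norm_eq_abs]

lemma abs_exp_neg_sub_exp_neg_le_one {a b : ℝ} (ha : 0 ≤ a) (hb : 0 ≤ b) :
    |Real.exp (-a) - Real.exp (-b)| ≤ 1 := by
  have ha' := Real.exp_le_one_iff.mpr (neg_nonpos.mpr ha)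
  have hb' := Real.exp_le_one_iff.mpr (neg_nonpos.mpr hb)
  rw [abs_le]
  constructor <;> linarith [Real.exp_pos (-a), Real.exp_pos (-b)]

lemma integrableOn_abs_exp_neg_sub_mul_norm {h : ℝ → ℂ} (hInt : IntegrableOn h (Set.Ioi 0))
    {ε ε' : ℝ} (hε : 0 ≤ ε) (hε' : 0 ≤ ε') :
    IntegrableOn (fun s : ℝ => |Real.exp (-(ε * s)) - Real.exp (-(ε' * s))| * ‖h s‖)
      (Set.Ioi 0) := by
  refine Integrable.bdd_mul (c := 1) hInt.norm
    (Continuous.aestronglyMeasurable (by fun_prop)) ?_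
  filter_upwards [ae_restrict_mem measurableSet_Ioi] with s hs
  rw [Real.norm_eq_abs, abs_abs]
  exact abs_exp_neg_sub_exp_neg_le_one (mul_nonneg hε (le_of_lt hs))
    (mul_nonneg hε' (le_of_lt hs))

lemma tendsto_integral_abs_exp_neg_sub_mul_norm {h : ℝ → ℂ}
    (hInt : IntegrableOn h (Set.Ioi 0)) {ε' : ℝ} (hε' : 0 ≤ ε') :
    Tendsto (fun ε : ℝ => ∫ s in Set.Ioi (0 : ℝ),
      |Real.exp (-(ε * s)) - Real.exp (-(ε' * s))| * ‖h s‖) (𝓝[Set.Ici 0] ε') (𝓝 0) := by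
  rw [show 𝓝 (0 : ℝ) = 𝓝 (∫ _ in Set.Ioi (0 : ℝ), (0 : ℝ)) by simp]
  refine tendsto_integral_filter_of_dominated_convergence (fun s => ‖h s‖) ?_ ?_ hInt.norm ?_
  · filter_upwards [self_mem_nhdsWithin] with ε hε
    exact (integrableOn_abs_exp_neg_sub_mul_norm hInt hε hε').aestronglyMeasurable
  · filter_upwards [self_mem_nhdsWithin] with ε hε
    filter_upwards [ae_restrict_mem measurableSet_Ioi] with s hs
    rw [Real.norm_of_nonneg (by positivity)]
    exact mul_le_of_le_one_left (norm_nonneg _) (abs_exp_neg_sub_exp_neg_le_one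
      (mul_nonneg hε (le_of_lt hs)) (mul_nonneg hε' (le_of_lt hs)))
  · refine Eventually.of_forall fun s => ?_
    have hcont : Continuous fun ε : ℝ =>
        |Real.exp (-(ε * s)) - Real.exp (-(ε' * s))| * ‖h s‖ := by fun_prop
    simpa using (hcont.tendsto ε').mono_left nhdsWithin_le_nhds

lemma norm_integral_exp_neg_add_mul_I_mul_sub_le {h : ℝ → ℂ}
    (hInt : IntegrableOn h (Set.Ioi 0)) {ε ε' : ℝ} (hε : 0 ≤ ε) (hε' : 0 ≤ ε') (η : ℝ) :
    ‖(∫ s in Set.Ioi (0 : ℝ),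
        Complex.exp (-((ε : ℂ) + (η : ℂ) * Complex.I) * (s : ℂ)) * h s) -
      ∫ s in Set.Ioi (0 : ℝ),
        Complex.exp (-((ε' : ℂ) + (η : ℂ) * Complex.I) * (s : ℂ)) * h s‖ ≤
      ∫ s in Set.Ioi (0 : ℝ), |Real.exp (-(ε * s)) - Real.exp (-(ε' * s))| * ‖h s‖ := by
  rw [← integral_sub (integrableOn_exp_neg_add_mul_I_mul hInt hε η)
    (integrableOn_exp_neg_add_mul_I_mul hInt hε' η)]
  refine norm_integral_le_of_norm_le (integrableOn_abs_exp_neg_sub_mul_norm hInt hε hε')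
    (Eventually.of_forall fun s => ?_)
  rw [← sub_mul, norm_mul, norm_exp_neg_add_mul_I_mul_sub]

/-- Uniform Riemann–Lebesgue lemma: for `h` Lebesgue integrable on `(0,∞)`,
`sup_{ε ∈ [0,1]} |∫₀^∞ e^{-(ε+iη)s} h(s) ds| → 0` as `|η| → ∞`. -/
theorem uniform_riemann_lebesgue (h : ℝ → ℂ) (hInt : IntegrableOn h (Set.Ioi 0)) :
    ∀ δ : ℝ, 0 < δ → ∃ R : ℝ, 0 < R ∧ ∀ η : ℝ, R ≤ |η| → ∀ ε ∈ Set.Icc (0 : ℝ) 1,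
      ‖∫ s in Set.Ioi (0 : ℝ),
          Complex.exp (-((ε : ℂ) + (η : ℂ) * Complex.I) * (s : ℂ)) * h s‖ ≤ δ := by
  intro δ hδ
  suffices hev : ∀ᶠ η : ℝ in cocompact ℝ, ∀ ε ∈ Set.Icc (0 : ℝ) 1,
      ‖∫ s in Set.Ioi (0 : ℝ),
        Complex.exp (-((ε : ℂ) + (η : ℂ) * Complex.I) * (s : ℂ)) * h s‖ ≤ δ by
    rw [← Metric.cobounded_eq_cocompact, ← comap_norm_atTop, eventually_comap, eventually_atTop] at hev
    obtain ⟨R, hR⟩ := hev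
    exact ⟨max R 1, by positivity, fun η hη => hR |η| (le_of_max_le_left hη) η rfl⟩
  refine isCompact_Icc.induction_on
    (p := fun K : Set ℝ => ∀ᶠ η : ℝ in cocompact ℝ, ∀ ε ∈ K, ‖∫ s in Set.Ioi (0 : ℝ),
      Complex.exp (-((ε : ℂ) + (η : ℂ) * Complex.I) * (s : ℂ)) * h s‖ ≤ δ)
    (by simp) (fun K L hKL hL => hL.mono fun η hη ε hε => hη ε (hKL hε)) ?_ ?_
  · intro K L hK hL
    filter_upwards [hK, hL] with η hηK hηL ε hε
    exact hε.elim (hηK ε) (hηL ε)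
  · intro ε' hε'
    have hclose := ((tendsto_integral_abs_exp_neg_sub_mul_norm hInt hε'.1).mono_left
      (nhdsWithin_mono ε' fun _ (hε : _ ∈ Set.Icc (0 : ℝ) 1) => hε.1)).eventually_lt_const
        (half_pos hδ)
    refine ⟨_, hclose.and self_mem_nhdsWithin, ?_⟩
    filter_upwards [(tendsto_integral_exp_neg_add_mul_I_mul h ε').norm.eventually_lt_const
      (by simpa using half_pos hδ : ‖(0 : ℂ)‖ < δ / 2)] with η hη ε hε
    have hdiff := norm_integral_exp_neg_add_mul_I_mul_sub_le hInt hε.2.1 hε'.1 η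
    refine (norm_le_norm_sub_add _ _).trans ((add_le_add (hdiff.trans hε.1.le) hη.le).trans ?_)
    exact (add_halves δ).le
end
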